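/- Let d = 2 and let β > 8 be a real number, and let G be the good-word collection of X^2_β over A = {1,2}. Then for every n ≥ 1 and every pair of words v, w ∈ G of length n, there exists a word u ∈ A² of length 2 such that the concatenation vuw belongs to G. -/

import Mathlib

open MeasureTheory Filter Real Set

/-- The left shift on bi-infinite sequences. -/
def shift {A : Type*} (x : ℤ → A) : ℤ → A := fun n => x (n + 1)

/-- `w` occurs as a factor (finite subword) of the bi-infinite sequence `x`. -/
def FactorOf {A : Type*} (w : List A) (x : ℤ → A) : Prop :=
  ∃ i : ℤ, ∀ t : ℕ, (ht : t < w.length) → x (i + t) = w[t]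

/-- `ℓ` is a period of the word `w`. -/
def HasPeriodN {A : Type*} (w : List A) (ℓ : ℕ) : Prop :=
  1 ≤ ℓ ∧ ℓ ≤ w.length ∧ ∀ t : ℕ, (ht : t + ℓ < w.length) →
    w[t]'(lt_of_le_of_lt (Nat.le_add_right t ℓ) ht) = w[t + ℓ]

/-- The `d`-ary `β`-free shift. -/
def betaFree (d : ℕ) (β : ℝ) : Set (ℤ → Fin d) :=
  {x | ∀ w : List (Fin d), FactorOf w x → ∀ ℓ : ℕ, HasPeriodN w ℓ → (w.length : ℝ) < β * ℓ}

/-- The language of a shift space. -/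
def language {A : Type*} (X : Set (ℤ → A)) : Set (List A) :=
  {w | ∃ x ∈ X, FactorOf w x}

/-- The words of length `n` in the language of `X`. -/
def langN {A : Type*} (X : Set (ℤ → A)) (n : ℕ) : Set (List A) :=
  {w | w ∈ language X ∧ w.length = n}

/-- The cylinder of a word. -/
def cylinder {A : Type*} (w : List A) : Set (ℤ → A) :=
  {x | ∀ t : ℕ, (ht : t < w.length) → x (t : ℤ) = w[t]}

/-- A shift space: closed and shift-invariant. -/
def IsShiftSpace {A : Type*} [TopologicalSpace A] (X : Set (ℤ → A)) : Prop :=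
  IsClosed X ∧ shift '' X = X

/-- Invariance of a measure under the shift. -/
def IsShiftInvariant {A : Type*} [MeasurableSpace A] (μ : Measure (ℤ → A)) : Prop :=
  ∀ E : Set (ℤ → A), MeasurableSet E → μ (shift ⁻¹' E) = μ E

/-- The `n`-th partition sum `H_n(μ) = Σ_w −μ[w] log μ[w]`. -/
noncomputable def cylEntropySum {A : Type*} [Fintype A] [MeasurableSpace A]
    (μ : Measure (ℤ → A)) (n : ℕ) : ℝ :=
  ∑ w : Fin n → A, Real.negMulLog (μ (cylinder (List.ofFn w))).toReal

/-- `μ` is a measure of maximal entropy on `X` (with topological entropy `h`). -/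
def IsMME {A : Type*} [Fintype A] [MeasurableSpace A]
    (X : Set (ℤ → A)) (h : ℝ) (μ : Measure (ℤ → A)) : Prop :=
  IsProbabilityMeasure μ ∧ μ X = 1 ∧ IsShiftInvariant μ ∧
    Tendsto (fun n : ℕ => cylEntropySum μ n / n) atTop (nhds h)

/-- A word is a 4-power. -/
def IsFourPower {A : Type*} (s : List A) : Prop :=
  ∃ v : List A, v ≠ [] ∧ s = v ++ v ++ v ++ v

/-- Good words: words of the language no prefix or suffix of which is a 4-power. -/
def goodWords {A : Type*} (X : Set (ℤ → A)) : Set (List A) :=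
  {w | w ∈ language X ∧ (∀ p : List A, p <+: w → ¬ IsFourPower p) ∧
       (∀ s : List A, s <:+ w → ¬ IsFourPower s)}

/-- Words of the language that are concatenations of 4-powers of words of the language. -/
def fourPowerConcat {A : Type*} (X : Set (ℤ → A)) : Set (List A) :=
  {w | w ∈ language X ∧ ∃ ps : List (List A),
      (∀ p ∈ ps, ∃ v ∈ language X, v ≠ [] ∧ p = v ++ v ++ v ++ v) ∧ w = ps.flatten}

/-- Alternating concatenation `w₁u₁w₂u₂⋯`. -/
def alternate {A : Type*} : List (List A) → List (List A) → List A
  | [], _ => []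
  | w :: _, [] => w
  | w :: ws, u :: us => w ++ u ++ alternate ws us

/-- The map deleting the first `i` and the last `k` symbols of a word. -/
def phi {A : Type*} (i k : ℕ) (w : List A) : List A := (w.drop i).take (w.length - i - k)

/-- Maximal `k` such that the first `k` symbols of `w` follow the periodic
pattern of period `ℓ` determined by the prefix of `w` of length `ℓ`. -/
noncomputable def preK {A : Type*} (w : List A) (ℓ : ℕ) : ℕ :=
  sSup {k | k ≤ w.length ∧ ∀ t < k, w[t]? = w[t % ℓ]?}

/-- `pre_ℓ(w)`: the number of times the length-`ℓ` prefix of `w` repeats at the start of `w`. -/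
noncomputable def pre {A : Type*} (w : List A) (ℓ : ℕ) : ℝ := (preK w ℓ : ℝ) / ℓ

/-- `suf_ℓ(w)`: the number of times the length-`ℓ` suffix of `w` repeats at the end of `w`. -/
noncomputable def suf {A : Type*} (w : List A) (ℓ : ℕ) : ℝ := pre w.reverse ℓ

/-- The letters of `w` at positions in `[i, j)` repeat with period `ℓ`. -/
def PeriodicOn {A : Type*} (w : List A) (i j ℓ : ℕ) : Prop :=
  ∀ t, i ≤ t → t + ℓ < j → w[t]? = w[t + ℓ]?

/-- A finite word that is `β`-free and has no 4-power as a prefix or as a suffix,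
phrased through positions and without reference to bi-infinite sequences. -/
structure FinitelyGood {A : Type*} (β : ℝ) (w : List A) : Prop where
  free : ∀ ℓ, 1 ≤ ℓ → ∀ i m, i + m ≤ w.length → PeriodicOn w i (i + m) ℓ → (m : ℝ) < β * ℓ
  start_free : ∀ ℓ, 1 ≤ ℓ → 4 * ℓ ≤ w.length → ¬ PeriodicOn w 0 (4 * ℓ) ℓ
  end_free : ∀ ℓ, 1 ≤ ℓ → 4 * ℓ ≤ w.length →
    ¬ PeriodicOn w (w.length - 4 * ℓ) w.length ℓ

theorem isFourPower_iff {A : Type*} (s : List A) :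
    IsFourPower s ↔ ∃ ℓ, 1 ≤ ℓ ∧ s.length = 4 * ℓ ∧ PeriodicOn s 0 (4 * ℓ) ℓ := by
  constructor
  · rintro ⟨v, hv, rfl⟩
    have hpos := List.length_pos_iff.2 hv
    refine ⟨v.length, hpos, by simp; ring, fun t _ ht => ?_⟩
    have h1 : (v ++ v ++ v ++ v)[t]? = (v ++ v ++ v)[t]? :=
      List.getElem?_append_left (by simp; omega)
    have h2 : (v ++ v ++ v ++ v)[t + v.length]? = (v ++ v ++ v)[t]? := by
      rw [show v ++ v ++ v ++ v = v ++ (v ++ v ++ v) by simp,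
        List.getElem?_append_right (by omega), Nat.add_sub_cancel]
    rw [h1, h2]
  · rintro ⟨ℓ, hℓ, hs, hp⟩
    have hlen : (s.take ℓ).length = ℓ := by simp; omega
    refine ⟨s.take ℓ, by rw [← List.length_pos_iff]; omega, ?_⟩
    apply List.ext_getElem?
    intro t
    by_cases h4 : 4 * ℓ ≤ t
    · rw [List.getElem?_eq_none (by omega), List.getElem?_eq_none (by simp; omega)]
    · have e0 : ∀ t < ℓ, (s.take ℓ)[t]? = s[t]? := fun t ht => by
        rw [List.getElem?_take_of_lt ht]
      simp only [List.append_assoc, List.getElem?_append, hlen]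
      split_ifs with h1 h2 h3
      · rw [e0 t h1]
      · rw [e0 _ (by omega), hp (t - ℓ) (by omega) (by omega)]
        congr 1; omega
      · rw [e0 _ (by omega), hp (t - ℓ - ℓ) (by omega) (by omega),
          hp (t - ℓ - ℓ + ℓ) (by omega) (by omega)]
        congr 1; omega
      · rw [e0 _ (by omega), hp (t - ℓ - ℓ - ℓ) (by omega) (by omega),
          hp (t - ℓ - ℓ - ℓ + ℓ) (by omega) (by omega),
          hp (t - ℓ - ℓ - ℓ + ℓ + ℓ) (by omega) (by omega)]
        congr 1; omega

theorem not_isFourPower_start_iff {A : Type*} (w : List A) :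
    (∀ p, p <+: w → ¬ IsFourPower p) ↔
      ∀ ℓ, 1 ≤ ℓ → 4 * ℓ ≤ w.length → ¬ PeriodicOn w 0 (4 * ℓ) ℓ := by
  constructor
  · intro h ℓ hℓ hlen hp
    refine h (w.take (4 * ℓ)) ⟨_, List.take_append_drop _ _⟩ ((isFourPower_iff _).2 ⟨ℓ, hℓ, by simp; omega, ?_⟩)
    intro t h0 ht
    rw [List.getElem?_take_of_lt (by omega), List.getElem?_take_of_lt (by omega)]
    exact hp t h0 ht
  · rintro h p ⟨r, rfl⟩ hp
    obtain ⟨ℓ, hℓ, hs, hp⟩ := (isFourPower_iff _).1 hp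
    refine h ℓ hℓ (by simp; omega) fun t h0 ht => ?_
    rw [List.getElem?_append_left (by omega), List.getElem?_append_left (by omega)]
    exact hp t h0 ht

theorem not_isFourPower_end_iff {A : Type*} (w : List A) :
    (∀ s, s <:+ w → ¬ IsFourPower s) ↔
      ∀ ℓ, 1 ≤ ℓ → 4 * ℓ ≤ w.length → ¬ PeriodicOn w (w.length - 4 * ℓ) w.length ℓ := by
  constructor
  · intro h ℓ hℓ hlen hp
    refine h (w.drop (w.length - 4 * ℓ)) (List.drop_suffix _ _)
      ((isFourPower_iff _).2 ⟨ℓ, hℓ, by simp; omega, ?_⟩)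
    intro t _ ht
    rw [List.getElem?_drop, List.getElem?_drop, ← add_assoc]
    exact hp _ (by omega) (by omega)
  · rintro h p ⟨r, rfl⟩ hp
    obtain ⟨ℓ, hℓ, hs, hp⟩ := (isFourPower_iff _).1 hp
    refine h ℓ hℓ (by simp; omega) fun t h0 ht => ?_
    simp only [List.length_append] at h0 ht
    rw [List.getElem?_append_right (by omega), List.getElem?_append_right (by omega),
      hp (t - r.length) (by omega) (by omega)]
    congr 1; omega

theorem finitelyGood_of_mem_goodWords {d : ℕ} {β : ℝ} (hβ : 1 < β) {w : List (Fin d)}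
    (hw : w ∈ goodWords (betaFree d β)) : FinitelyGood β w := by
  obtain ⟨⟨x, hx, i₀, hi₀⟩, hpre, hsuf⟩ := hw
  refine ⟨fun ℓ hℓ i m him hp => ?_, (not_isFourPower_start_iff w).1 hpre,
    (not_isFourPower_end_iff w).1 hsuf⟩
  have hℓ' : (0 : ℝ) < ℓ := by exact_mod_cast hℓ
  by_cases hm : m < ℓ
  · have : (m : ℝ) < ℓ := by exact_mod_cast hm
    nlinarith
  have hlen : ((w.drop i).take m).length = m := by simp; omega
  have key := hx ((w.drop i).take m) ⟨i₀ + i, fun t ht => ?_⟩ ℓ ⟨hℓ, by omega, fun t ht => ?_⟩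
  · rwa [hlen] at key
  · rw [hlen] at ht
    have := hi₀ (i + t) (by omega)
    simp only [List.getElem_take, List.getElem_drop]
    rw [← this]; push_cast; ring_nf
  · rw [hlen] at ht
    have := hp (i + t) (by omega) (by omega)
    rw [List.getElem?_eq_getElem (by omega), List.getElem?_eq_getElem (by omega)] at this
    simpa [add_assoc] using this

theorem exists_letter_not_continuing_right (v : List (Fin 2)) :
    ∃ a : Fin 2, ∀ ℓ, 1 ≤ ℓ → 2 * ℓ ≤ v.length + 1 → PeriodicOn v 0 v.length ℓ →
      v[v.length - ℓ]? ≠ some a := by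
  by_contra! h
  obtain ⟨k, hk, hk2, hkp, hk0⟩ := h 0
  obtain ⟨l, hl, hl2, hlp, hl1⟩ := h 1
  have hkl : k ≠ l := by rintro rfl; simp [hk0] at hl1
  have e1 := hlp (v.length - k - l) (by omega) (by omega)
  have e2 := hkp (v.length - k - l) (by omega) (by omega)
  rw [show v.length - k - l + l = v.length - k by omega, hk0] at e1
  rw [show v.length - k - l + k = v.length - l by omega, hl1] at e2
  simp [e1] at e2

theorem exists_letter_not_continuing_left (w : List (Fin 2)) :
    ∃ a : Fin 2, ∀ ℓ, 1 ≤ ℓ → 2 * ℓ ≤ w.length + 1 → PeriodicOn w 0 w.length ℓ →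
      w[ℓ - 1]? ≠ some a := by
  by_contra! h
  obtain ⟨k, hk, hk2, hkp, hk0⟩ := h 0
  obtain ⟨l, hl, hl2, hlp, hl1⟩ := h 1
  have hkl : k ≠ l := by rintro rfl; simp [hk0] at hl1
  have e1 := hlp (k - 1) (by omega) (by omega)
  have e2 := hkp (l - 1) (by omega) (by omega)
  rw [hk0, show k - 1 + l = l - 1 + k by omega, ← e2, hl1] at e1
  simp at e1

theorem FinitelyGood.exists_append {β : ℝ} (hβ : 8 < β) {v w : List (Fin 2)}
    (hn : 1 ≤ v.length) (hvw : w.length = v.length)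
    (hv : FinitelyGood β v) (hw : FinitelyGood β w) :
    ∃ u : List (Fin 2), u.length = 2 ∧ FinitelyGood β (v ++ u ++ w) := by
  obtain ⟨a, ha⟩ := exists_letter_not_continuing_right v
  obtain ⟨b, hb⟩ := exists_letter_not_continuing_left w
  have hlen : (v ++ [a, b] ++ w).length = 2 * v.length + 2 := by simp; omega
  have hL : ∀ t < v.length, (v ++ [a, b] ++ w)[t]? = v[t]? := fun t ht => by
    rw [List.append_assoc, List.getElem?_append_left ht]
  have hR : ∀ t, (v ++ [a, b] ++ w)[v.length + 2 + t]? = w[t]? := fun t => by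
    rw [List.getElem?_append_right (by simp)]
    simp
  have hA : (v ++ [a, b] ++ w)[v.length]? = some a := by simp
  have hB : (v ++ [a, b] ++ w)[v.length + 1]? = some b := by simp
  refine ⟨[a, b], rfl, ?_⟩
  generalize v ++ [a, b] ++ w = x at *
  have perL : ∀ i j ℓ, j ≤ v.length → PeriodicOn x i j ℓ → PeriodicOn v i j ℓ := by
    intro i j ℓ hj hp t h0 ht
    rw [← hL _ (by omega), ← hL _ (by omega)]
    exact hp t h0 ht
  have perR : ∀ i j ℓ, PeriodicOn x (v.length + 2 + i) (v.length + 2 + j) ℓ →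
      PeriodicOn w i j ℓ := by
    intro i j ℓ hp t h0 ht
    rw [← hR, ← hR, ← add_assoc]
    exact hp _ (by omega) (by omega)
  have mono : ∀ {i j i' j' ℓ}, i ≤ i' → j' ≤ j → PeriodicOn x i j ℓ → PeriodicOn x i' j' ℓ :=
    fun hi hj hp t h0 ht => hp t (by omega) (by omega)
  refine ⟨fun ℓ hℓ i m him hp => ?_, fun ℓ hℓ h4 hp => ?_, fun ℓ hℓ h4 hp => ?_⟩
  · rw [hlen] at him
    by_cases h1 : i + m ≤ v.length
    · exact hv.free ℓ hℓ i m h1 (perL _ _ _ h1 hp)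
    by_cases h2 : v.length + 2 ≤ i
    · obtain ⟨c, rfl⟩ := Nat.exists_eq_add_of_le h2
      exact hw.free ℓ hℓ c m (by omega) (perR _ _ _ (mono le_rfl (by omega) hp))
    have h3 : v.length < i + 4 * ℓ := by
      by_contra h
      exact hv.end_free ℓ hℓ (by omega)
        (perL _ _ _ le_rfl (mono (by omega) (by omega) hp))
    have h4 : i + m < v.length + 2 + 4 * ℓ := by
      by_contra h
      exact hw.start_free ℓ hℓ (by omega) (perR _ _ _ (mono (by omega) (by omega) hp))
    have h5 : (m : ℝ) ≤ 8 * ℓ := by exact_mod_cast (by omega : m ≤ 8 * ℓ)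
    have h6 : (0 : ℝ) < ℓ := by exact_mod_cast hℓ
    nlinarith
  · rw [hlen] at h4
    by_cases h : 4 * ℓ ≤ v.length
    · exact hv.start_free ℓ hℓ h (perL _ _ _ h hp)
    refine ha ℓ hℓ (by omega) (perL _ _ _ le_rfl (mono le_rfl (by omega) hp)) ?_
    rw [← hL _ (by omega), hp _ (by omega) (by omega), ← hA]
    congr 1; omega
  · rw [hlen] at h4 hp
    by_cases h : 4 * ℓ ≤ w.length
    · exact hw.end_free ℓ hℓ h (perR _ _ _ (mono (by omega) (by omega) hp))
    refine hb ℓ hℓ (by omega) (perR _ _ _ (mono (by omega) (by omega) hp)) ?_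
    rw [← hR, ← hB, hp (v.length + 1) (by omega) (by omega)]
    congr 1; omega

theorem FinitelyGood.exists_extension {β : ℝ} (hβ : 8 < β) {z : List (Fin 2)}
    (hn : 1 ≤ z.length) (hz : FinitelyGood β z) :
    ∃ l r : List (Fin 2), 1 ≤ l.length ∧ 1 ≤ r.length ∧ FinitelyGood β (l ++ z ++ r) := by
  obtain ⟨u, hu, h1⟩ := hz.exists_append hβ hn rfl hz
  obtain ⟨u', hu', h2⟩ := h1.exists_append hβ (by simp; omega) rfl h1
  refine ⟨z ++ u, u' ++ (z ++ u ++ z), by simp; omega, by simp; omega, ?_⟩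
  simpa using h2

/-- A nested sequence of words, growing on both sides, converges to a bi-infinite sequence. -/
theorem exists_biinfinite_of_nested {A : Type*} (z l r : ℕ → List A)
    (hl : ∀ k, 1 ≤ (l k).length) (hr : ∀ k, 1 ≤ (r k).length) (h0 : 1 ≤ (z 0).length)
    (hz : ∀ k, z (k + 1) = l k ++ z k ++ r k) :
    ∃ (x : ℤ → A) (o : ℕ → ℕ), (∀ k, k ≤ o k) ∧ (∀ k, k + o k < (z k).length) ∧
      ∀ (k t : ℕ) (a : A), (z k)[t]? = some a → x ((t : ℤ) - o k) = a := by
  let o : ℕ → ℕ := fun k => ∑ j ∈ Finset.range k, (l j).length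
  have ho : ∀ k, o (k + 1) = o k + (l k).length := fun k => Finset.sum_range_succ _ _
  have o_ge : ∀ k, k ≤ o k := by
    intro k
    induction k with
    | zero => simp
    | succ k ih => have := ho k; have := hl k; omega
  have len_gt : ∀ k, k + o k < (z k).length := by
    intro k
    induction k with
    | zero => simp [o]; omega
    | succ k ih =>
      have := ho k; have := hr k
      rw [hz]; simp only [List.length_append]; omega
  have step : ∀ k m t a, (z k)[t]? = some a →
      o k ≤ o (k + m) ∧ (z (k + m))[t + (o (k + m) - o k)]? = some a := by
    intro k m t a h
    induction m with
    | zero => simpa using h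
    | succ m ih =>
      obtain ⟨h1, h2⟩ := ih
      have e := ho (k + m)
      rw [← add_assoc k m 1]
      refine ⟨by omega, ?_⟩
      obtain ⟨hlt, -⟩ := List.getElem?_eq_some_iff.1 h2
      rw [hz, List.append_assoc, List.getElem?_append_right (by omega),
        List.getElem?_append_left (by omega), ← h2]
      congr 1; omega
  have hdef : ∀ i : ℤ, ((i + o i.natAbs).toNat) < (z i.natAbs).length := fun i => by
    have := o_ge i.natAbs; have := len_gt i.natAbs; omega
  refine ⟨fun i => (z i.natAbs)[(i + o i.natAbs).toNat]'(hdef i), o, o_ge, len_gt, ?_⟩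
  intro k t a h
  generalize hi : (t : ℤ) - o k = i
  have hg := List.getElem?_eq_getElem (hdef i)
  have hoi := o_ge i.natAbs
  rcases Nat.le_total k i.natAbs with hk | hk
  · obtain ⟨m, hm⟩ := Nat.exists_eq_add_of_le hk
    obtain ⟨h1, h2⟩ := step k m t a h
    rw [← hm] at h1 h2
    rw [show t + (o i.natAbs - o k) = (i + o i.natAbs).toNat by omega, hg] at h2
    exact Option.some.inj h2
  · obtain ⟨m, hm⟩ := Nat.exists_eq_add_of_le hk
    obtain ⟨h1, h2⟩ := step _ m _ _ hg
    rw [← hm] at h1 h2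
    rw [show (i + o i.natAbs).toNat + (o k - o i.natAbs) = t by omega, h] at h2
    exact (Option.some.inj h2).symm

theorem FinitelyGood.mem_language {β : ℝ} (hβ : 8 < β) {z : List (Fin 2)}
    (hn : 1 ≤ z.length) (hz : FinitelyGood β z) : z ∈ language (betaFree 2 β) := by
  have h_ext : ∀ s : {s : List (Fin 2) // 1 ≤ s.length ∧ FinitelyGood β s},
      ∃ p : List (Fin 2) × List (Fin 2), 1 ≤ p.1.length ∧ 1 ≤ p.2.length ∧
        FinitelyGood β (p.1 ++ s.1 ++ p.2) := fun s => by
    obtain ⟨l, r, h⟩ := s.2.2.exists_extension hβ s.2.1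
    exact ⟨(l, r), h⟩
  choose p hp1 hp2 hp using h_ext
  let s : ℕ → {s : List (Fin 2) // 1 ≤ s.length ∧ FinitelyGood β s} := fun k =>
    Nat.rec ⟨z, hn, hz⟩
      (fun _ s => ⟨(p s).1 ++ s.1 ++ (p s).2, by have := hp1 s; simp; omega, hp s⟩) k
  obtain ⟨x, o, ho, hlen, hx⟩ := exists_biinfinite_of_nested (fun k => (s k).1)
    (fun k => (p (s k)).1) (fun k => (p (s k)).2) (fun k => hp1 _) (fun k => hp2 _) hn
    (fun k => rfl)
  refine ⟨x, ?_, -(o 0 : ℤ), fun t ht => ?_⟩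
  · rintro w ⟨i, hi⟩ ℓ ⟨hℓ, hℓw, hper⟩
    let k := i.natAbs + w.length
    have h1 := ho k
    have h2 : k + o k < (s k).1.length := hlen k
    have hc : ∀ t (ht : t < w.length), (s k).1[(i + o k).toNat + t]? = some w[t] := by
      intro t ht
      have hlt : (i + o k).toNat + t < (s k).1.length := by omega
      have h3 := hx k _ _ (List.getElem?_eq_getElem hlt)
      rw [List.getElem?_eq_getElem hlt, ← h3, ← hi t ht]
      congr 2; omega
    refine (s k).2.2.free ℓ hℓ (i + o k).toNat w.length (by omega) fun t h0 ht => ?_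
    obtain ⟨c, rfl⟩ := Nat.exists_eq_add_of_le h0
    rw [add_assoc, hc c (by omega), hc (c + ℓ) (by omega), hper c (by omega)]
  · have := hx 0 t _ (List.getElem?_eq_getElem ht)
    rw [← this]
    congr 1; omega

/-- Same-length specification with a two-symbol gap, for `d = 2` and `β > 8`. -/
theorem same_length_spec_two_symbols (β : ℝ) (hβ : 8 < β) :
    ∀ n : ℕ, 1 ≤ n → ∀ v w : List (Fin 2),
      v ∈ goodWords (betaFree 2 β) → w ∈ goodWords (betaFree 2 β) →
      v.length = n → w.length = n →
      ∃ u : List (Fin 2), u.length = 2 ∧ v ++ u ++ w ∈ goodWords (betaFree 2 β) := by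
  intro n hn v w hv hw hvn hwn
  have hβ' : 1 < β := by linarith
  obtain ⟨u, hu, hg⟩ := (finitelyGood_of_mem_goodWords hβ' hv).exists_append hβ
    (by omega) (by omega) (finitelyGood_of_mem_goodWords hβ' hw)
  exact ⟨u, hu, hg.mem_language hβ (by simp; omega),
    (not_isFourPower_start_iff _).2 hg.start_free,
    (not_isFourPower_end_iff _).2 hg.end_free⟩
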